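/- arXiv:1703.00663 — 3 statements merged into one kernel-verified Lean document; each statement's English description precedes it below -/
import Mathlib

section
/- For every real number a with 2 < a ≤ 3, the 6×6 matrix M_a has nonnegative rank exactly 4, i.e., rank₊(M_a) = 4. -/
/-- The nonnegative rank of a matrix: the smallest `r` such that `M = U * V`
with `U : p × r` and `V : r × n` entrywise nonnegative. -/
noncomputable def nnRank {p n : ℕ} (M : Matrix (Fin p) (Fin n) ℝ) : ℕ :=
  sInf {r : ℕ | ∃ (U : Matrix (Fin p) (Fin r) ℝ) (V : Matrix (Fin r) (Fin n) ℝ),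
    (∀ i k, 0 ≤ U i k) ∧ (∀ k j, 0 ≤ V k j) ∧ M = U * V}

/-- The nested-hexagon matrix `M_a` for a parameter `a`. -/
noncomputable def hexM (a : ℝ) : Matrix (Fin 6) (Fin 6) ℝ :=
  (1 / a) • !![1,     a,     2*a-1, 2*a-1, a,     1;
               1,     1,     a,     2*a-1, 2*a-1, a;
               a,     1,     1,     a,     2*a-1, 2*a-1;
               2*a-1, a,     1,     1,     a,     2*a-1;
               2*a-1, 2*a-1, a,     1,     1,     a;
               a,     2*a-1, 2*a-1, a,     1,     1]

open Matrix

/-- Slack vectors of the points of a hexagon, in homogeneous coordinates. -/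
def hexSlack : Matrix (Fin 6) (Fin 3) ℝ :=
  !![1, -1, 0; 1, -1, -1; 1, 0, -1; 1, 1, 0; 1, 1, 1; 1, 0, 1]

/-- The vertices of the hexagon scaled by `t`, in homogeneous coordinates. -/
def hexVertices (t : ℝ) : Matrix (Fin 3) (Fin 6) ℝ :=
  !![1, 1, 1, 1, 1, 1; t, 0, -t, -t, 0, t; 0, t, t, 0, -t, -t]

lemma hexM_eq_mul {a : ℝ} (ha : a ≠ 0) :
    hexM a = hexSlack * hexVertices ((a - 1) / a) := by
  ext i j
  fin_cases i <;> fin_cases j <;>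
    simp [hexM, hexSlack, hexVertices, Matrix.mul_apply, Fin.sum_univ_succ] <;>
    field_simp <;> ring

lemma exists_leftInverse_hexSlack : ∃ L : Matrix (Fin 3) (Fin 6) ℝ, L * hexSlack = 1 := by
  refine ⟨!![1/2, 0, 0, 1/2, 0, 0; -1/2, 0, 0, 1/2, 0, 0; 0, 0, -1/2, 0, 0, 1/2], ?_⟩
  ext i j
  fin_cases i <;> fin_cases j <;>
    norm_num [hexSlack, Matrix.mul_apply, Fin.sum_univ_succ]

lemma exists_rightInverse_hexVertices {t : ℝ} (ht : t ≠ 0) :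
    ∃ R : Matrix (Fin 6) (Fin 3) ℝ, hexVertices t * R = 1 := by
  refine ⟨!![1/2, 1/(2*t), 0; 0, 0, 1/(2*t); 0, 0, 0; 1/2, -(1/(2*t)), 0;
    0, 0, -(1/(2*t)); 0, 0, 0], ?_⟩
  ext i j
  fin_cases i <;> fin_cases j <;>
    simp [hexVertices, Matrix.mul_apply, Fin.sum_univ_succ] <;> field_simp <;> norm_num

/-- An affine function that is nonnegative on the vertices of the hexagon scaled by `t` is
nonnegative on the reflection through the centre of every point of the scaled hexagon. -/
lemma affine_nonneg_of_vertices_nonneg {c x y p l m t : ℝ}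
    (hP : ∀ i, 0 ≤ (hexSlack *ᵥ ![c, x, y]) i)
    (hQ : ∀ j, 0 ≤ (![p, l, m] ᵥ* hexVertices t) j) :
    0 ≤ p * c - t * (l * x + m * y) := by
  simp [Fin.forall_fin_succ, hexSlack, hexVertices, Matrix.mulVec, Matrix.vecMul, dotProduct,
    Fin.sum_univ_succ] at hP hQ
  obtain ⟨h0, h1, h2, h3, h4, h5⟩ := hP
  obtain ⟨g0, g1, g2, g3, g4, g5⟩ := hQ
  have hp : 0 ≤ p := by linarith
  replace h0 : 0 ≤ c - x := by linarith
  replace h1 : 0 ≤ c - x - y := by linarith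
  replace h2 : 0 ≤ c - y := by linarith
  replace g0 : 0 ≤ p + t * l := by linarith
  replace g1 : 0 ≤ p + t * m := by linarith
  replace g2 : 0 ≤ p - t * l + t * m := by linarith
  replace g3 : 0 ≤ p - t * l := by linarith
  replace g4 : 0 ≤ p - t * m := by linarith
  replace g5 : 0 ≤ p + t * l - t * m := by linarith
  rcases le_total 0 x with hx | hx <;> rcases le_total 0 y with hy | hy
  · nlinarith [mul_nonneg hp h1, mul_nonneg hx g3, mul_nonneg hy g4]
  · rcases le_total 0 (x + y) with hs | hs
    · nlinarith [mul_nonneg hp h0, mul_nonneg hs g3, mul_nonneg (neg_nonneg.2 hy) g2]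
    · nlinarith [mul_nonneg hp h5, mul_nonneg (neg_nonneg.2 hs) g1, mul_nonneg hx g2]
  · rcases le_total 0 (x + y) with hs | hs
    · nlinarith [mul_nonneg hp h2, mul_nonneg hs g4, mul_nonneg (neg_nonneg.2 hx) g5]
    · nlinarith [mul_nonneg hp h3, mul_nonneg (neg_nonneg.2 hs) g0, mul_nonneg hy g5]
  · nlinarith [mul_nonneg hp h4, mul_nonneg (neg_nonneg.2 hx) g0, mul_nonneg (neg_nonneg.2 hy) g1]

/-- A triangle nested between a hexagon and its copy scaled by `t` exists only if `t ≤ 1/2`;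
the columns of `P` are its vertices and the rows of `Q` its barycentric coordinates. -/
lemma two_mul_le_one_of_nested_triangle {t : ℝ} {P Q : Matrix (Fin 3) (Fin 3) ℝ}
    (hPQ : P * Q = 1) (hP : ∀ i k, 0 ≤ (hexSlack * P) i k)
    (hQ : ∀ k j, 0 ≤ (Q * hexVertices t) k j) : 2 * t ≤ 1 := by
  have hQP : Q * P = 1 := mul_eq_one_comm.1 hPQ
  have key (k : Fin 3) : t ≤ (1 + t) * (Q k 0 * P 0 k) := by
    have h := affine_nonneg_of_vertices_nonneg (c := P 0 k) (x := P 1 k) (y := P 2 k)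
      (p := Q k 0) (l := Q k 1) (m := Q k 2) (t := t)
      (fun i => by
        simpa [Matrix.mul_apply, Matrix.mulVec, dotProduct, Fin.sum_univ_succ] using hP i k)
      (fun j => by
        simpa [Matrix.mul_apply, Matrix.vecMul, dotProduct, Fin.sum_univ_succ] using hQ k j)
    have hk : (Q * P) k k = 1 := by simp [hQP]
    simp only [Matrix.mul_apply, Fin.sum_univ_three] at hk
    linear_combination h - t * hk
  have h00 : (P * Q) 0 0 = 1 := by simp [hPQ]
  simp only [Matrix.mul_apply, Fin.sum_univ_three] at h00
  linear_combination key 0 + key 1 + key 2 + (1 + t) * h00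

lemma four_le_of_hexM_eq_mul {a : ℝ} (ha : 2 < a) {r : ℕ} {U : Matrix (Fin 6) (Fin r) ℝ}
    {V : Matrix (Fin r) (Fin 6) ℝ} (hU : ∀ i k, 0 ≤ U i k) (hV : ∀ k j, 0 ≤ V k j)
    (hM : hexM a = U * V) : 4 ≤ r := by
  set t := (a - 1) / a with ht
  have ht0 : 1 < 2 * t := by
    rw [ht, ← mul_div_assoc, lt_div_iff₀ (by linarith)]
    linarith
  rw [hexM_eq_mul (by linarith), ← ht] at hM
  obtain ⟨L, hL⟩ := exists_leftInverse_hexSlack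
  obtain ⟨R, hR⟩ := exists_rightInverse_hexVertices (t := t) (by linarith)
  have hLU : L * U * V = hexVertices t := by
    rw [Matrix.mul_assoc, ← hM, ← Matrix.mul_assoc, hL, Matrix.one_mul]
  have hVR : U * (V * R) = hexSlack := by
    rw [← Matrix.mul_assoc, ← hM, Matrix.mul_assoc, hR, Matrix.mul_one]
  have hPQ : (L * U) * (V * R) = 1 := by
    rw [← Matrix.mul_assoc, hLU, hR]
  have hr : 3 ≤ r := by
    have h := Matrix.rank_mul_le_left (L * U) (V * R)
    rw [hPQ, Matrix.rank_one, Fintype.card_fin] at h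
    exact h.trans (Matrix.rank_le_width (L * U))
  by_contra! hlt
  obtain rfl : r = 3 := by omega
  have hQP : (V * R) * (L * U) = 1 := mul_eq_one_comm.1 hPQ
  refine ht0.not_ge (two_mul_le_one_of_nested_triangle hPQ (fun i k => ?_) (fun k j => ?_))
  · rw [← hVR, Matrix.mul_assoc, hQP, Matrix.mul_one]
    exact hU i k
  · rw [← hLU, ← Matrix.mul_assoc, hQP, Matrix.one_mul]
    exact hV k j

/-- The factorization given by a rhombus nested between the two hexagons. -/
lemma exists_hexM_eq_mul_four {a : ℝ} (ha₁ : 1 ≤ a) (ha₃ : a ≤ 3) :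
    ∃ (U : Matrix (Fin 6) (Fin 4) ℝ) (V : Matrix (Fin 4) (Fin 6) ℝ),
      (∀ i k, 0 ≤ U i k) ∧ (∀ k j, 0 ≤ V k j) ∧ hexM a = U * V := by
  refine ⟨!![0, 2, 3/2, 1/2; 0, 2, 1/2, 3/2; 1, 1, 0, 2; 2, 0, 1/2, 3/2; 2, 0, 3/2, 1/2;
      1, 1, 2, 0],
    (1 / a) • !![(2*a-1)/2, (a+1)/4, (3-a)/4, 1/2, (3-a)/4, (a+1)/4;
      1/2, (3-a)/4, (a+1)/4, (2*a-1)/2, (a+1)/4, (3-a)/4;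
      0, a-1, a-1, 0, 0, 0;
      0, 0, 0, 0, a-1, a-1], ?_, ?_, ?_⟩
  · intro i k
    fin_cases i <;> fin_cases k <;> norm_num
  · intro k j
    refine mul_nonneg (by positivity) ?_
    fin_cases k <;> fin_cases j <;> simp <;> linarith
  · rw [Matrix.mul_smul, hexM]
    congr 1
    ext i j
    fin_cases i <;> fin_cases j <;> simp [Matrix.mul_apply, Fin.sum_univ_succ] <;> ring

/-- For every `2 < a ≤ 3`, the hexagon matrix has nonnegative rank exactly 4. -/
theorem nnRank_hexM_eq_four {a : ℝ} (ha₂ : 2 < a) (ha₃ : a ≤ 3) :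
    nnRank (hexM a) = 4 := by
  refine IsLeast.csInf_eq ⟨exists_hexM_eq_mul_four (by linarith) ha₃, ?_⟩
  rintro r ⟨U, V, hU, hV, hM⟩
  exact four_le_of_hexM_eq_mul ha₂ hU hV hM
end

section
/- For every real number a > 3, the 6×6 matrix M_a has nonnegative rank exactly 5, i.e., rank₊(M_a) = 5. -/
theorem hexagon_area_bound_of_ordered {x y u w B : ℝ} (hy : 0 ≤ y) (hyx : y ≤ x) (hx : x ≤ 1) (hw : 0 ≤ w)
    (hwu : w ≤ u) (hu : u ≤ 1) (h1 : x + w ≤ B) (h2 : y + u ≤ B) (h3 : x - y + (u - w) ≤ B) :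
    3 * (x * u - y * w) ≤ 2 * B := by
  by_contra hcon
  push Not at hcon
  have k1 : 2 * (x + w) < 3 * (x * u - y * w) := by linarith
  have k2 : 2 * (y + u) < 3 * (x * u - y * w) := by linarith
  have k3 : 2 * (x - y + (u - w)) < 3 * (x * u - y * w) := by linarith
  rcases le_total y w with h | h
  · nlinarith [mul_nonneg hy hw, mul_nonneg (sub_nonneg.2 hyx) (sub_nonneg.2 hu),
      mul_nonneg (sub_nonneg.2 hwu) (sub_nonneg.2 hx),
      mul_nonneg hy (sub_nonneg.2 h), mul_nonneg (sub_nonneg.2 hx) (sub_nonneg.2 hu)]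
  · nlinarith [mul_nonneg hy hw, mul_nonneg (sub_nonneg.2 hyx) (sub_nonneg.2 hu),
      mul_nonneg (sub_nonneg.2 hwu) (sub_nonneg.2 hx),
      mul_nonneg hw (sub_nonneg.2 h), mul_nonneg (sub_nonneg.2 hx) (sub_nonneg.2 hu)]

/-- Given four vectors with a strictly positive relation and an independent relation, two of the
vectors lie in the negative of the cone spanned by the other two. -/
theorem exists_perm_neg_mem_cone {E : Type*} [AddCommGroup E] [Module ℝ E]
    (P : Fin 4 → E) (c d : Fin 4 → ℝ)
    (hc : ∀ k, 0 < c k) (hcP : ∑ k, c k • P k = 0) (hdP : ∑ k, d k • P k = 0) (hd : d ≠ 0)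
    (hd0 : d 0 = 0) :
    ∃ (σ : Equiv.Perm (Fin 4)) (α β γ δ : ℝ), 0 ≤ α ∧ 0 ≤ β ∧ 0 ≤ γ ∧ 0 ≤ δ ∧
      P (σ 0) = -(α • P (σ 2) + β • P (σ 3)) ∧ P (σ 1) = -(γ • P (σ 2) + δ • P (σ 3)) := by
  obtain ⟨b, -, hb⟩ := Finset.univ.exists_max_image (fun k => d k / c k) Finset.univ_nonempty
  obtain ⟨a, -, ha⟩ := Finset.univ.exists_min_image (fun k => d k / c k) Finset.univ_nonempty
  have hlt : d a / c a < d b / c b := by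
    by_contra hle
    push Not at hle
    refine hd (funext fun k => ?_)
    have h0 := hb 0 (Finset.mem_univ _)
    have h1 := ha 0 (Finset.mem_univ _)
    have h2 := hb k (Finset.mem_univ _)
    have h3 := ha k (Finset.mem_univ _)
    simp only [hd0, zero_div] at h0 h1
    have : d k / c k = 0 := by linarith
    simpa [(hc k).ne'] using this
  have hab : a ≠ b := by rintro rfl; exact lt_irrefl _ hlt
  obtain ⟨σ, rfl, rfl⟩ : ∃ σ : Equiv.Perm (Fin 4), σ 0 = a ∧ σ 1 = b := by
    clear hb ha hlt; revert a b; decide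
  have key : ∀ (e : Fin 4 → ℝ) (i j : Fin 4), (∀ k, 0 ≤ e k) → 0 < e i → e j = 0 →
      (∑ k, e k • P k = e i • P i + e j • P j + e (σ 2) • P (σ 2) + e (σ 3) • P (σ 3)) →
      ∑ k, e k • P k = 0 → ∃ α β : ℝ, 0 ≤ α ∧ 0 ≤ β ∧ P i = -(α • P (σ 2) + β • P (σ 3)) := by
    intro e i j he hi hj hs h0
    refine ⟨e (σ 2) / e i, e (σ 3) / e i, div_nonneg (he _) hi.le, div_nonneg (he _) hi.le, ?_⟩
    rw [h0, hj, zero_smul, add_zero] at hs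
    have : P i = (e i)⁻¹ • (e i • P i) := by rw [smul_smul, inv_mul_cancel₀ hi.ne', one_smul]
    rw [this, show e i • P i = -(e (σ 2) • P (σ 2) + e (σ 3) • P (σ 3)) from
      eq_neg_of_add_eq_zero_left (by rw [hs]; abel), smul_neg, smul_add, smul_smul, smul_smul,
      div_eq_inv_mul, div_eq_inv_mul]
  have hcomb : ∀ x y : ℝ, ∑ k, (x * c k + y * d k) • P k = 0 := fun x y => by
    simp_rw [add_smul, mul_smul, Finset.sum_add_distrib, ← Finset.smul_sum, hcP, hdP]
    simp
  obtain ⟨α, β, hα, hβ, h0⟩ := key (fun k => d (σ 1) / c (σ 1) * c k + -1 * d k) (σ 0) (σ 1)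
    (fun k => by
      have := (div_le_iff₀ (hc k)).1 (hb k (Finset.mem_univ _))
      linarith)
    (by have := (div_lt_iff₀ (hc _)).1 hlt
        linarith)
    (by have := (hc (σ 1)).ne'
        field_simp; ring)
    (by rw [← Equiv.sum_comp σ, Fin.sum_univ_four]) (hcomb _ _)
  obtain ⟨γ, δ, hγ, hδ, h1⟩ := key (fun k => -(d (σ 0) / c (σ 0)) * c k + 1 * d k) (σ 1) (σ 0)
    (fun k => by
      have := (le_div_iff₀ (hc k)).1 (ha k (Finset.mem_univ _))
      linarith)
    (by have := (lt_div_iff₀ (hc _)).1 hlt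
        linarith)
    (by have := (hc (σ 0)).ne'
        field_simp; ring)
    (by rw [← Equiv.sum_comp σ, Fin.sum_univ_four]; abel) (hcomb _ _)
  exact ⟨σ, α, β, γ, δ, hα, hβ, hγ, hδ, h0, h1⟩

/-- If two of four vectors lie in the negative cone of the other two, a convex combination of the
normalized vectors satisfies three of the four inequalities of the symmetric parallelogram spanned
by the other two. -/
theorem exists_coord_bound_of_neg_cone {E : Type*} [NormedAddCommGroup E]
    [NormedSpace ℝ E] {P : Fin 4 → E}
    {σ : Equiv.Perm (Fin 4)} {α β γ δ : ℝ} (hα : 0 ≤ α) (hβ : 0 ≤ β) (hγ : 0 ≤ γ) (hδ : 0 ≤ δ)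
    (h0 : P (σ 0) = -(α • P (σ 2) + β • P (σ 3))) (h1 : P (σ 1) = -(γ • P (σ 2) + δ • P (σ 3)))
    {f : Fin 4 → ℝ} (hf : ∀ k, 0 ≤ f k) (hf1 : ∑ k, f k * ‖P k‖ ≤ 1) :
    ∃ x y : ℝ, ∑ k, f k • P k = x • P (σ 2) + y • P (σ 3) ∧ x * ‖P (σ 2)‖ + y * ‖P (σ 3)‖ ≤ 1 ∧
      |x * ‖P (σ 2)‖ - y * ‖P (σ 3)‖| ≤ 1 := by
  have tri : ∀ (p q r : E) (a b : ℝ), 0 ≤ a → 0 ≤ b → r = -(a • p + b • q) →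
      |a * ‖p‖ - b * ‖q‖| ≤ ‖r‖ := by
    intro p q r a b ha hb hr
    have := abs_norm_sub_norm_le (a • p) (-(b • q))
    rwa [norm_neg, sub_neg_eq_add, ← norm_neg (a • p + b • q), ← hr, norm_smul, norm_smul,
      Real.norm_of_nonneg ha, Real.norm_of_nonneg hb] at this
  have t0 := abs_le.1 (tri _ _ _ _ _ hα hβ h0)
  have t1 := abs_le.1 (tri _ _ _ _ _ hγ hδ h1)
  rw [← Equiv.sum_comp σ, Fin.sum_univ_four] at hf1
  refine ⟨f (σ 2) - f (σ 0) * α - f (σ 1) * γ, f (σ 3) - f (σ 0) * β - f (σ 1) * δ, ?_, ?_, ?_⟩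
  · rw [← Equiv.sum_comp σ, Fin.sum_univ_four, h0, h1]
    module
  · have a0 := mul_nonneg (hf (σ 0)) (norm_nonneg (P (σ 0)))
    have a1 := mul_nonneg (hf (σ 1)) (norm_nonneg (P (σ 1)))
    have := mul_nonneg (hf (σ 0)) (mul_nonneg hα (norm_nonneg (P (σ 2))))
    have := mul_nonneg (hf (σ 0)) (mul_nonneg hβ (norm_nonneg (P (σ 3))))
    have := mul_nonneg (hf (σ 1)) (mul_nonneg hγ (norm_nonneg (P (σ 2))))
    have := mul_nonneg (hf (σ 1)) (mul_nonneg hδ (norm_nonneg (P (σ 3))))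
    linarith
  · have a0 := mul_nonneg (hf (σ 2)) (norm_nonneg (P (σ 2)))
    have a1 := mul_nonneg (hf (σ 3)) (norm_nonneg (P (σ 3)))
    have b0 := mul_le_mul_of_nonneg_left t0.1 (hf (σ 0))
    have b1 := mul_le_mul_of_nonneg_left t0.2 (hf (σ 0))
    have b2 := mul_le_mul_of_nonneg_left t1.1 (hf (σ 1))
    have b3 := mul_le_mul_of_nonneg_left t1.2 (hf (σ 1))
    rw [abs_le]
    constructor <;> linarith

theorem abs_cross_le_of_signed {a₀ a₁ a₂ b₀ b₁ b₂ B : ℝ} (ha : a₀ + a₁ + a₂ = 0)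
    (hb : b₀ + b₁ + b₂ = 0)
    (h₁ : a₁ ≤ 0) (h₂ : a₂ ≤ 0) (ha₀ : |a₀| ≤ 1) (hb₀ : |b₀| ≤ 1) (hb₁ : |b₁| ≤ 1)
    (hb₂ : |b₂| ≤ 1) (h0 : |a₀| + |b₀| ≤ B) (h1 : |a₁| + |b₁| ≤ B) (h2 : |a₂| + |b₂| ≤ B) :
    3 * |a₀ * b₁ - a₁ * b₀| ≤ 2 * B := by
  have same : ∀ {x y u w : ℝ}, 0 ≤ y → y ≤ x → x ≤ 1 → 0 ≤ w → w ≤ u → u ≤ 1 → x + u ≤ B →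
      3 * |x * w - y * u| ≤ 2 * B := by
    intro x y u w _ _ _ _ _ _ _
    rcases abs_cases (x * w - y * u) with ⟨h, _⟩ | ⟨h, _⟩ <;> rw [h] <;> nlinarith
  have opp : ∀ {x y u w : ℝ}, 0 ≤ y → y ≤ x → x ≤ 1 → 0 ≤ w → w ≤ u → u ≤ 1 → x + w ≤ B →
      y + u ≤ B → x - y + (u - w) ≤ B → 3 * |x * u - y * w| ≤ 2 * B := by
    intro x y u w hy hyx hx hw hwu hu h1 h2 h3
    rw [abs_of_nonneg (by nlinarith)]
    exact hexagon_area_bound_of_ordered hy hyx hx hw hwu hu h1 h2 h3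
  rw [abs_of_nonneg (show 0 ≤ a₀ by linarith)] at ha₀ h0
  rw [abs_of_nonpos h₁] at h1
  rw [abs_of_nonpos h₂] at h2
  obtain rfl : a₂ = -(a₀ + a₁) := by linarith
  obtain rfl : b₂ = -(b₀ + b₁) := by linarith
  rw [abs_le] at hb₀ hb₁ hb₂
  rcases abs_cases b₀ with ⟨e0, s0⟩ | ⟨e0, s0⟩ <;> rcases abs_cases b₁ with ⟨e1, s1⟩ | ⟨e1, s1⟩ <;>
    rcases abs_cases (-(b₀ + b₁)) with ⟨e2, s2⟩ | ⟨e2, s2⟩ <;> rw [e0] at h0 <;> rw [e1] at h1 <;>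
    rw [e2] at h2
  all_goals first
    | (refine le_trans (le_of_eq ?_) (same (x := a₀) (y := -a₁) (u := b₀) (w := -b₁) (by linarith)
        (by linarith) (by linarith) (by linarith) (by linarith) (by linarith) (by linarith))
       rw [← abs_neg]; ring_nf)
    | (refine le_trans (le_of_eq ?_) (same (x := a₀) (y := -a₁) (u := -b₀) (w := b₁) (by linarith)
        (by linarith) (by linarith) (by linarith) (by linarith) (by linarith) (by linarith))
       ring_nf)
    | (refine le_trans (le_of_eq ?_) (opp (x := a₀) (y := -a₁) (u := b₁) (w := -b₀) (by linarith)
        (by linarith) (by linarith) (by linarith) (by linarith) (by linarith) (by linarith)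
        (by linarith) (by linarith))
       ring_nf)
    | (refine le_trans (le_of_eq ?_) (opp (x := a₀) (y := -a₁) (u := -b₁) (w := b₀) (by linarith)
        (by linarith) (by linarith) (by linarith) (by linarith) (by linarith) (by linarith)
        (by linarith) (by linarith))
       rw [← abs_neg]; ring_nf)
    | (refine le_trans (le_of_eq ?_) (opp (x := a₀) (y := a₀ + a₁) (u := -(b₀ + b₁)) (w := -b₀)
        (by linarith) (by linarith) (by linarith) (by linarith) (by linarith) (by linarith)
        (by linarith) (by linarith) (by linarith))
       rw [← abs_neg]; ring_nf)
    | (refine le_trans (le_of_eq ?_) (opp (x := a₀) (y := a₀ + a₁) (u := b₀ + b₁) (w := b₀)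
        (by linarith) (by linarith) (by linarith) (by linarith) (by linarith) (by linarith)
        (by linarith) (by linarith) (by linarith))
       ring_nf)

/-- For two triples with zero sum and entries in `[-1, 1]`, their cross product is at most `2 / 3`
of the largest sum of absolute values of matching entries. -/
theorem abs_cross_le_of_sum_eq_zero {a₀ a₁ a₂ b₀ b₁ b₂ B : ℝ} (ha : a₀ + a₁ + a₂ = 0)
    (hb : b₀ + b₁ + b₂ = 0)
    (ha₀ : |a₀| ≤ 1) (ha₁ : |a₁| ≤ 1) (ha₂ : |a₂| ≤ 1) (hb₀ : |b₀| ≤ 1) (hb₁ : |b₁| ≤ 1)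
    (hb₂ : |b₂| ≤ 1) (h0 : |a₀| + |b₀| ≤ B) (h1 : |a₁| + |b₁| ≤ B) (h2 : |a₂| + |b₂| ≤ B) :
    3 * |a₀ * b₁ - a₁ * b₀| ≤ 2 * B := by
  have r1 : a₀ * b₁ - a₁ * b₀ = a₁ * b₂ - a₂ * b₁ := by
    linear_combination b₁ * ha - a₁ * hb
  have r2 : a₀ * b₁ - a₁ * b₀ = a₂ * b₀ - a₀ * b₂ := by
    linear_combination a₀ * hb - b₀ * ha
  have n0 : |a₀ * b₁ - a₁ * b₀| = |(-a₀) * b₁ - (-a₁) * b₀| := by rw [← abs_neg]; ring_nf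
  have n1 : |a₁ * b₂ - a₂ * b₁| = |(-a₁) * b₂ - (-a₂) * b₁| := by rw [← abs_neg]; ring_nf
  have n2 : |a₂ * b₀ - a₀ * b₂| = |(-a₂) * b₀ - (-a₀) * b₂| := by rw [← abs_neg]; ring_nf
  rcases le_total a₀ 0 with s0 | s0 <;> rcases le_total a₁ 0 with s1 | s1 <;>
    rcases le_total a₂ 0 with s2 | s2
  all_goals first
    | exact abs_cross_le_of_signed ha hb (by linarith) (by linarith) ha₀ hb₀ hb₁ hb₂ h0 h1 h2
    | (rw [r1]
       exact abs_cross_le_of_signed (by linarith) (by linarith) (by linarith) (by linarith) ha₁ hb₁ hb₂ hb₀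
         h1 h2 h0)
    | (rw [r2]
       exact abs_cross_le_of_signed (by linarith) (by linarith) (by linarith) (by linarith) ha₂ hb₂ hb₀ hb₁
         h2 h0 h1)
    | (rw [n0]
       exact abs_cross_le_of_signed (a₂ := -a₂) (by linarith) hb (by linarith) (by linarith) (by rwa [abs_neg])
         hb₀ hb₁ hb₂ (by rwa [abs_neg]) (by rwa [abs_neg]) (by rwa [abs_neg]))
    | (rw [r1, n1]
       exact abs_cross_le_of_signed (a₂ := -a₀) (b₂ := b₀) (by linarith) (by linarith) (by linarith)
         (by linarith) (by rwa [abs_neg]) hb₁ hb₂ hb₀ (by rwa [abs_neg]) (by rwa [abs_neg])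
         (by rwa [abs_neg]))
    | (rw [r2, n2]
       exact abs_cross_le_of_signed (a₂ := -a₁) (b₂ := b₁) (by linarith) (by linarith) (by linarith)
         (by linarith) (by rwa [abs_neg]) hb₂ hb₀ hb₁ (by rwa [abs_neg]) (by rwa [abs_neg])
         (by rwa [abs_neg]))

/-- `abs_cross_le_of_sum_eq_zero` for plane points written as `(x, y, x - y)`. -/
theorem abs_cross_le_of_abs_le_one {p q : Fin 3 → ℝ} (hp : p 2 = p 0 - p 1) (hq : q 2 = q 0 - q 1)
    (hp1 : ∀ i, |p i| ≤ 1) (hq1 : ∀ i, |q i| ≤ 1) {B : ℝ} (hB : ∀ i, |p i| + |q i| ≤ B) :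
    3 * |p 0 * q 1 - p 1 * q 0| ≤ 2 * B := by
  have := abs_cross_le_of_sum_eq_zero (a₀ := p 0) (a₁ := -p 1) (a₂ := -p 2) (b₀ := q 0) (b₁ := -q 1)
    (b₂ := -q 2) (B := B) (by rw [hp]; ring) (by rw [hq]; ring) (hp1 0) (by rw [abs_neg]; exact hp1 1)
    (by rw [abs_neg]; exact hp1 2) (hq1 0) (by rw [abs_neg]; exact hq1 1)
    (by rw [abs_neg]; exact hq1 2) (hB 0) (by simpa only [abs_neg] using hB 1)
    (by simpa only [abs_neg] using hB 2)
  rwa [show p 0 * -q 1 - -p 1 * q 0 = -(p 0 * q 1 - p 1 * q 0) by ring, abs_neg] at this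

/-- If the parallelogram with vertices `±p / ‖p‖`, `±q / ‖q‖` contains `t` times the hexagon
`‖(x, y, x - y)‖ ≤ 1`, then `t ≤ 2 / 3`. -/
theorem scale_le_of_parallelogram {p q : Fin 3 → ℝ} (hp : p 2 = p 0 - p 1) (hq : q 2 = q 0 - q 1)
    (hD : p 0 * q 1 - p 1 * q 0 ≠ 0) {t : ℝ} (ht : 0 < t)
    (h : ∀ i, t * (|q i| * ‖p‖ + |p i| * ‖q‖) ≤ |p 0 * q 1 - p 1 * q 0|) : 3 * t ≤ 2 := by
  have hp0 : 0 < ‖p‖ := norm_pos_iff.2 fun h => hD (by simp [h])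
  have hq0 : 0 < ‖q‖ := norm_pos_iff.2 fun h => hD (by simp [h])
  have hpi : ∀ i, |p i| ≤ ‖p‖ := fun i => norm_le_pi_norm p i
  have hqi : ∀ i, |q i| ≤ ‖q‖ := fun i => norm_le_pi_norm q i
  have hE : ‖p‖⁻¹ * p 0 * (‖q‖⁻¹ * q 1) - ‖p‖⁻¹ * p 1 * (‖q‖⁻¹ * q 0) =
      (p 0 * q 1 - p 1 * q 0) * (‖p‖⁻¹ * ‖q‖⁻¹) := by ring
  have hpos : 0 < ‖p‖⁻¹ * ‖q‖⁻¹ := by positivity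
  have := abs_cross_le_of_abs_le_one (p := ‖p‖⁻¹ • p) (q := ‖q‖⁻¹ • q)
    (B := |p 0 * q 1 - p 1 * q 0| * (‖p‖⁻¹ * ‖q‖⁻¹) / t)
    (by simp only [Pi.smul_apply, smul_eq_mul, hp]; ring)
    (by simp only [Pi.smul_apply, smul_eq_mul, hq]; ring)
    (fun i => by
      rw [Pi.smul_apply, smul_eq_mul, abs_mul, abs_of_pos (inv_pos.2 hp0), inv_mul_le_one₀ hp0]
      exact hpi i)
    (fun i => by
      rw [Pi.smul_apply, smul_eq_mul, abs_mul, abs_of_pos (inv_pos.2 hq0), inv_mul_le_one₀ hq0]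
      exact hqi i)
    (fun i => by
      rw [le_div_iff₀ ht]
      simp only [Pi.smul_apply, smul_eq_mul, abs_mul, abs_of_pos (inv_pos.2 hp0),
        abs_of_pos (inv_pos.2 hq0)]
      have := mul_le_mul_of_nonneg_right (h i) hpos.le
      refine le_trans (le_of_eq ?_) this
      field_simp
      ring)
  simp only [Pi.smul_apply, smul_eq_mul] at this
  rw [hE, abs_mul, abs_of_pos hpos, ← mul_div_assoc, le_div_iff₀ ht] at this
  have hX : 0 < |p 0 * q 1 - p 1 * q 0| * (‖p‖⁻¹ * ‖q‖⁻¹) := mul_pos (abs_pos.2 hD) hpos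
  nlinarith

/-- The vertices of the hexagon `|x|, |y|, |x - y| ≤ 1`, in the coordinates `(x, y, x - y)`. -/
def hexVertex : Fin 6 → Fin 3 → ℝ :=
  ![![-1, -1, 0], ![0, -1, 1], ![1, 0, 1], ![1, 1, 0], ![0, 1, -1], ![-1, 0, -1]]

/-- No convex hull of four points of the hexagon contains its dilate by a factor `t > 2 / 3`. -/
theorem not_hexagon_subset_quadrilateral {t : ℝ} (ht : 2 / 3 < t) (P : Fin 4 → Fin 3 → ℝ)
    (hP : ∀ k, P k 2 = P k 0 - P k 1)
    (H : ∀ j, ∃ f : Fin 4 → ℝ, (∀ k, 0 ≤ f k) ∧ ∑ k, f k * ‖P k‖ ≤ 1 ∧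
      ∑ k, f k • P k = t • hexVertex j) : False := by
  have ht0 : 0 < t := by linarith
  choose f hf hf1 hfP using H
  obtain ⟨c, hc, hcP⟩ : ∃ c : Fin 4 → ℝ, (∀ k, 0 < c k) ∧ ∑ k, c k • P k = 0 := by
    set S := ∑ k, P k with hS
    have hS2 : S 2 = S 0 - S 1 := by
      simp only [hS, Finset.sum_apply, hP, Finset.sum_sub_distrib]
    refine ⟨fun k => 1 + t⁻¹ * (|S 0| * f 2 k + (|S 0| + S 0) * f 5 k + |S 1| * f 4 k +
      (|S 1| + S 1) * f 1 k), fun k => ?_, ?_⟩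
    · have := hf 2 k
      have := hf 5 k
      have := hf 4 k
      have := hf 1 k
      have : 0 ≤ |S 0| + S 0 := by linarith [neg_abs_le (S 0)]
      have : 0 ≤ |S 1| + S 1 := by linarith [neg_abs_le (S 1)]
      positivity
    · have : ∀ k, (1 + t⁻¹ * (|S 0| * f 2 k + (|S 0| + S 0) * f 5 k + |S 1| * f 4 k +
          (|S 1| + S 1) * f 1 k)) • P k = P k + t⁻¹ • (|S 0| • f 2 k • P k +
          (|S 0| + S 0) • f 5 k • P k + |S 1| • f 4 k • P k + (|S 1| + S 1) • f 1 k • P k) :=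
        fun k => by module
      simp only [this, Finset.sum_add_distrib, ← Finset.smul_sum, hfP, ← hS]
      ext i
      fin_cases i <;> simp [hexVertex, hS2] <;> field_simp <;> ring
  obtain ⟨d, hd, hdP⟩ := Matrix.exists_mulVec_eq_zero_iff.2
    (show Matrix.det !![P 0 0, P 1 0, P 2 0, P 3 0; P 0 1, P 1 1, P 2 1, P 3 1; 1, 0, 0, 0;
      0, 0, 0, 0] = 0 from Matrix.det_eq_zero_of_row_eq_zero 3 (by intro j; fin_cases j <;> rfl))
  have g0 := congrFun hdP 0
  have g1 := congrFun hdP 1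
  have g2 := congrFun hdP 2
  simp [Matrix.mulVec, dotProduct, Fin.sum_univ_four] at g0 g1 g2
  obtain ⟨σ, α, β, γ, δ, hα, hβ, hγ, hδ, h0, h1⟩ := exists_perm_neg_mem_cone P c d hc hcP
    (by
      ext i
      fin_cases i
      · simp [Fin.sum_univ_four, g2]; rw [g2] at g0 g1; linarith
      · simp [Fin.sum_univ_four, g2]; rw [g2] at g0 g1; linarith
      · simp [Fin.sum_univ_four, hP, g2]; rw [g2] at g0 g1; linarith) hd g2
  have L := fun j => exists_coord_bound_of_neg_cone hα hβ hγ hδ h0 h1 (hf j) (hf1 j)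
  choose x y hxy hs hdif using L
  simp only [hfP] at hxy
  have e0 : ∀ j, t * hexVertex j 0 = x j * P (σ 2) 0 + y j * P (σ 3) 0 := fun j => by
    simpa using congrFun (hxy j) 0
  have e1 : ∀ j, t * hexVertex j 1 = x j * P (σ 2) 1 + y j * P (σ 3) 1 := fun j => by
    simpa using congrFun (hxy j) 1
  have hp := hP (σ 2)
  have hq := hP (σ 3)
  clear hxy h0 h1
  generalize P (σ 2) = p at *
  generalize P (σ 3) = q at *
  have hxD : ∀ j, x j * (p 0 * q 1 - p 1 * q 0) =
      t * (hexVertex j 0 * q 1 - hexVertex j 1 * q 0) := fun j => by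
    linear_combination q 0 * e1 j - q 1 * e0 j
  have hyD : ∀ j, y j * (p 0 * q 1 - p 1 * q 0) =
      t * (p 0 * hexVertex j 1 - p 1 * hexVertex j 0) := fun j => by
    linear_combination p 1 * e0 j - p 0 * e1 j
  have hD : p 0 * q 1 - p 1 * q 0 ≠ 0 := by
    intro hD
    have a0 := e0 2
    have a1 := e1 2
    have b0 := e0 4
    have b1 := e1 4
    simp [hexVertex] at a0 a1 b0 b1
    have : t * t = 0 := by
      calc t * t = (x 2 * p 0 + y 2 * q 0) * (x 4 * p 1 + y 4 * q 1) -
            (x 2 * p 1 + y 2 * q 1) * (x 4 * p 0 + y 4 * q 0) := by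
              rw [← a0, ← a1, ← b0, ← b1]; ring
        _ = (x 2 * y 4 - x 4 * y 2) * (p 0 * q 1 - p 1 * q 0) := by ring
        _ = 0 := by rw [hD, mul_zero]
    nlinarith
  have hle : ∀ j j', hexVertex j' = -hexVertex j → |x j| * ‖p‖ + |y j| * ‖q‖ ≤ 1 := by
    intro j j' hjj
    have hx : x j' = -x j := mul_right_cancel₀ hD (by
      rw [neg_mul, hxD, hxD, hjj]; simp only [Pi.neg_apply]; ring)
    have hy : y j' = -y j := mul_right_cancel₀ hD (by
      rw [neg_mul, hyD, hyD, hjj]; simp only [Pi.neg_apply]; ring)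
    have s1 := hs j
    have s2 := hs j'
    rw [hx, hy] at s2
    obtain ⟨s3, s4⟩ := abs_le.1 (hdif j)
    rcases abs_cases (x j) with ⟨h, _⟩ | ⟨h, _⟩ <;> rcases abs_cases (y j) with ⟨h', _⟩ | ⟨h', _⟩ <;>
      rw [h, h'] <;> linarith
  have par : ∀ (i : Fin 3) (j j' : Fin 6), hexVertex j' = -hexVertex j →
      |hexVertex j 0 * q 1 - hexVertex j 1 * q 0| = |q i| →
      |p 0 * hexVertex j 1 - p 1 * hexVertex j 0| = |p i| →
      t * (|q i| * ‖p‖ + |p i| * ‖q‖) ≤ |p 0 * q 1 - p 1 * q 0| := by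
    intro i j j' hjj hqi hpi
    have h1 : |x j| * |p 0 * q 1 - p 1 * q 0| = t * |q i| := by
      rw [← abs_mul, hxD, abs_mul, hqi, abs_of_pos ht0]
    have h2 : |y j| * |p 0 * q 1 - p 1 * q 0| = t * |p i| := by
      rw [← abs_mul, hyD, abs_mul, hpi, abs_of_pos ht0]
    calc t * (|q i| * ‖p‖ + |p i| * ‖q‖) = (|x j| * ‖p‖ + |y j| * ‖q‖) * |p 0 * q 1 - p 1 * q 0| := by
          linear_combination -‖p‖ * h1 - ‖q‖ * h2
      _ ≤ _ := mul_le_of_le_one_left (abs_nonneg _) (hle j j' hjj)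
  have := scale_le_of_parallelogram hp hq hD ht0 fun i => by
    fin_cases i
    · exact par 0 4 1 (by simp [hexVertex]) (by simp [hexVertex]) (by simp [hexVertex])
    · exact par 1 2 5 (by simp [hexVertex]) (by simp [hexVertex]) (by simp [hexVertex])
    · exact par 2 3 0 (by simp [hexVertex])
        (by rw [hq, abs_sub_comm]; simp [hexVertex]) (by rw [hp]; simp [hexVertex])
  linarith

/-- `hexM a` has no nonnegative factorization of inner dimension 4 whose left factor has its columns
in the column space of `hexM a`. -/
theorem hexM_ne_mul_of_columns_mem_range {a : ℝ} (ha : 3 < a) (U : Matrix (Fin 6) (Fin 4) ℝ)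
    (V : Matrix (Fin 4) (Fin 6) ℝ)
    (hU : ∀ i k, 0 ≤ U i k) (hV : ∀ k j, 0 ≤ V k j) (hM : hexM a = U * V)
    (r1 : ∀ k, U 0 k + U 3 k = U 1 k + U 4 k) (r2 : ∀ k, U 0 k + U 3 k = U 2 k + U 5 k)
    (r3 : ∀ k, U 5 k - U 2 k = (U 0 k - U 3 k) - (U 1 k - U 4 k)) : False := by
  have ha0 : 0 < a := by linarith
  have key : ∀ i j, hexM a i j = ∑ k, U i k * V k j := fun i j => by rw [hM]; rfl
  refine not_hexagon_subset_quadrilateral (t := (a - 1) / a) (by rw [lt_div_iff₀ ha0]; linarith)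
    (fun k => ![(U 0 k - U 3 k) / 2, (U 1 k - U 4 k) / 2, (U 5 k - U 2 k) / 2]) (fun k => ?_)
    (fun j => ⟨fun k => V k j, fun k => hV k j, ?_, ?_⟩)
  · simp; linarith [r3 k]
  · have : ∀ k, ‖![(U 0 k - U 3 k) / 2, (U 1 k - U 4 k) / 2, (U 5 k - U 2 k) / 2]‖ ≤
        (U 0 k + U 3 k) / 2 := fun k => by
      refine (pi_norm_le_iff_of_nonneg (by linarith [hU 0 k, hU 3 k])).2 fun i => ?_
      have := hU 0 k
      have := hU 1 k
      have := hU 2 k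
      have := hU 3 k
      have := hU 4 k
      have := hU 5 k
      have := r1 k
      have := r2 k
      fin_cases i <;> simp only [Real.norm_eq_abs] <;> rw [abs_le] <;> simp <;> constructor <;> linarith
    calc ∑ k, V k j * ‖![(U 0 k - U 3 k) / 2, (U 1 k - U 4 k) / 2, (U 5 k - U 2 k) / 2]‖
      _ ≤ ∑ k, V k j * ((U 0 k + U 3 k) / 2) :=
        Finset.sum_le_sum fun k _ => mul_le_mul_of_nonneg_left (this k) (hV k j)
      _ = (hexM a 0 j + hexM a 3 j) / 2 := by
        rw [key, key, ← Finset.sum_add_distrib, Finset.sum_div]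
        exact Finset.sum_congr rfl fun k _ => by ring
      _ ≤ 1 := by
        refine le_of_eq ?_
        fin_cases j <;> simp [hexM] <;> field_simp <;> ring
  · have l : ∀ i i', ∑ k, V k j * ((U i k - U i' k) / 2) = (hexM a i j - hexM a i' j) / 2 := by
      intro i i'
      rw [key, key, ← Finset.sum_sub_distrib, Finset.sum_div]
      exact Finset.sum_congr rfl fun k _ => by ring
    ext i
    rw [Finset.sum_apply]
    fin_cases i
    · simp [l]
      fin_cases j <;> simp [hexM, hexVertex] <;> field_simp <;> ring
    · simp [l]
      fin_cases j <;> simp [hexM, hexVertex] <;> field_simp <;> ring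
    · simp [l]
      fin_cases j <;> simp [hexM, hexVertex] <;> field_simp <;> ring

/-- `hexM a` has no nonnegative factorization of inner dimension 4: one of the factors must have
rank 3, and `hexM a` agrees with its transpose up to a cyclic shift. -/
theorem hexM_ne_mul_of_nonneg {a : ℝ} (ha : 3 < a) (U : Matrix (Fin 6) (Fin 4) ℝ)
    (V : Matrix (Fin 4) (Fin 6) ℝ)
    (hU : ∀ i k, 0 ≤ U i k) (hV : ∀ k j, 0 ≤ V k j) (hM : hexM a = U * V) : False := by
  have ha0 : a ≠ 0 := by linarith
  have ha1 : a - 1 ≠ 0 := by linarith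
  by_cases hinj : ∀ x : Fin 4 → ℝ, Matrix.vecMul x V = 0 → x = 0
  · have key : ∀ l : Fin 6 → ℝ, Matrix.vecMul l (hexM a) = 0 → Matrix.vecMul l U = 0 := fun l hl =>
      hinj _ (by rw [Matrix.vecMul_vecMul, ← hM, hl])
    have k1 := key ![1, -1, 0, 1, -1, 0] (by
      ext j; fin_cases j <;> simp [hexM, Matrix.vecMul, dotProduct, Fin.sum_univ_six] <;> ring)
    have k2 := key ![1, 0, -1, 1, 0, -1] (by
      ext j; fin_cases j <;> simp [hexM, Matrix.vecMul, dotProduct, Fin.sum_univ_six] <;> ring)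
    have k3 := key ![-1, 1, -1, 1, -1, 1] (by
      ext j; fin_cases j <;> simp [hexM, Matrix.vecMul, dotProduct, Fin.sum_univ_six])
    refine hexM_ne_mul_of_columns_mem_range ha U V hU hV hM (fun k => ?_) (fun k => ?_) (fun k => ?_)
    · have := congrFun k1 k
      simp [Matrix.vecMul, dotProduct, Fin.sum_univ_six] at this
      linarith
    · have := congrFun k2 k
      simp [Matrix.vecMul, dotProduct, Fin.sum_univ_six] at this
      linarith
    · have := congrFun k3 k
      simp [Matrix.vecMul, dotProduct, Fin.sum_univ_six] at this
      linarith
  · push Not at hinj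
    obtain ⟨x, hx, hx0⟩ := hinj
    have hVr : V.rank ≤ 3 := by
      have h := LinearMap.finrank_range_add_finrank_ker V.transpose.mulVecLin
      have hpos : 0 < Module.finrank ℝ (LinearMap.ker V.transpose.mulVecLin) := by
        refine Module.finrank_pos_iff_exists_ne_zero.2 ⟨⟨x, ?_⟩, fun h => hx0 (congrArg Subtype.val h)⟩
        simpa [Matrix.mulVec_transpose] using hx
      rw [← Matrix.rank_transpose, Matrix.rank]
      simp at h
      omega
    have hMr : 3 ≤ (hexM a).rank := by
      have hdet : ((hexM a).submatrix ![0, 1, 2] ![0, 1, 2]).det = (a - 1) ^ 2 / a ^ 2 := by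
        rw [Matrix.det_fin_three]
        simp [hexM]
        field_simp
        ring
      have hr := Matrix.rank_of_isUnit _ ((Matrix.isUnit_iff_isUnit_det _).2
        (isUnit_iff_ne_zero.2 (hdet ▸ div_ne_zero (pow_ne_zero 2 ha1) (pow_ne_zero 2 ha0))))
      rw [Fintype.card_fin] at hr
      exact hr.ge.trans (Matrix.rank_submatrix_le _ _ _)
    have hker : LinearMap.ker V.mulVecLin = LinearMap.ker (hexM a).mulVecLin := by
      refine Submodule.eq_of_le_of_finrank_le ?_ ?_
      · intro z hz
        simp only [LinearMap.mem_ker, Matrix.mulVecLin_apply] at hz ⊢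
        rw [hM, ← Matrix.mulVec_mulVec, hz, Matrix.mulVec_zero]
      · have h1 := LinearMap.finrank_range_add_finrank_ker V.mulVecLin
        have h2 := LinearMap.finrank_range_add_finrank_ker (hexM a).mulVecLin
        rw [Matrix.rank] at hVr hMr
        omega
    have key : ∀ l : Fin 6 → ℝ, (hexM a).mulVec l = 0 → V.mulVec l = 0 := fun l hl => by
      have : l ∈ LinearMap.ker V.mulVecLin := by rw [hker]; simpa using hl
      simpa using this
    have k1 := key ![1, -1, 0, 1, -1, 0] (by
      ext j; fin_cases j <;> simp [hexM, Matrix.mulVec, dotProduct, Fin.sum_univ_six] <;> ring)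
    have k2 := key ![1, 0, -1, 1, 0, -1] (by
      ext j; fin_cases j <;> simp [hexM, Matrix.mulVec, dotProduct, Fin.sum_univ_six] <;> ring)
    have k3 := key ![-1, 1, -1, 1, -1, 1] (by
      ext j; fin_cases j <;> simp [hexM, Matrix.mulVec, dotProduct, Fin.sum_univ_six])
    refine hexM_ne_mul_of_columns_mem_range ha V.transpose (Matrix.of fun k j => U (j + 1) k)
      (fun i k => hV k i) (fun k j => hU _ _) ?_ (fun k => ?_) (fun k => ?_) (fun k => ?_)
    · ext i j
      have : hexM a i j = hexM a (j + 1) i := by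
        fin_cases i <;> fin_cases j <;> simp [hexM]
      rw [this, hM, Matrix.mul_apply, Matrix.mul_apply]
      exact Finset.sum_congr rfl fun k _ => mul_comm _ _
    · have := congrFun k1 k
      simp [Matrix.mulVec, dotProduct, Fin.sum_univ_six] at this
      simp only [Matrix.transpose_apply]
      linarith
    · have := congrFun k2 k
      simp [Matrix.mulVec, dotProduct, Fin.sum_univ_six] at this
      simp only [Matrix.transpose_apply]
      linarith
    · have := congrFun k3 k
      simp [Matrix.mulVec, dotProduct, Fin.sum_univ_six] at this
      simp only [Matrix.transpose_apply]
      linarith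

/-- Nonnegative factorizations can be padded by zeros. -/
theorem exists_nonneg_factorization_of_le {p n r s : ℕ} (hrs : r ≤ s) {M : Matrix (Fin p) (Fin n) ℝ}
    (h : ∃ (U : Matrix (Fin p) (Fin r) ℝ) (V : Matrix (Fin r) (Fin n) ℝ),
      (∀ i k, 0 ≤ U i k) ∧ (∀ k j, 0 ≤ V k j) ∧ M = U * V) :
    ∃ (U : Matrix (Fin p) (Fin s) ℝ) (V : Matrix (Fin s) (Fin n) ℝ),
      (∀ i k, 0 ≤ U i k) ∧ (∀ k j, 0 ≤ V k j) ∧ M = U * V := by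
  induction s, hrs using Nat.le_induction with
  | base => exact h
  | succ s _ ih =>
    obtain ⟨U, V, hU, hV, rfl⟩ := ih
    refine ⟨Matrix.of fun i => Fin.snoc (U i) 0,
      Matrix.of fun k j => Fin.snoc (α := fun _ => ℝ) (fun k => V k j) 0 k, fun i k => ?_, fun k j => ?_, ?_⟩
    · refine Fin.lastCases ?_ (fun k => ?_) k
      · simp
      · simpa using hU i k
    · refine Fin.lastCases ?_ (fun k => ?_) k
      · simp
      · simpa using hV k j
    · ext i j
      simp [Matrix.mul_apply, Fin.sum_univ_castSucc]

theorem exists_nonneg_factorization_hexM_five {a : ℝ} (ha : 1 < a) :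
    ∃ (U : Matrix (Fin 6) (Fin 5) ℝ) (V : Matrix (Fin 5) (Fin 6) ℝ),
      (∀ i k, 0 ≤ U i k) ∧ (∀ k j, 0 ≤ V k j) ∧ hexM a = U * V := by
  have ha0 : 0 < a := by linarith
  have ha1 : 0 ≤ a - 1 := by linarith
  refine ⟨!![0, 1, 0, 1, 0; 0, 1, 1, 0, 0; 0, 0, 2, 0, 1; 1, 0, 1, 0, 0; 1, 0, 0, 1, 0; 0, 0, 0, 2, 1],
    (1 / a) • !![2 * (a - 1) + 1, a - 1 + 1, 1, 1, 1, a - 1 + 1;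
      1, 1, a - 1 + 1, 2 * (a - 1) + 1, a - 1 + 1, 1;
      0, 0, 0, 0, a - 1, a - 1;
      0, a - 1, a - 1, 0, 0, 0;
      a - 1 + 1, 1, 1, a - 1 + 1, 1, 1], fun i k => ?_, fun k j => ?_, ?_⟩
  · fin_cases i <;> fin_cases k <;> simp
  · rw [Matrix.smul_apply, smul_eq_mul]
    refine mul_nonneg (by positivity) ?_
    fin_cases k <;> fin_cases j <;> simp <;> linarith
  · rw [Matrix.mul_smul, hexM]
    congr 1
    ext i j
    fin_cases i <;> fin_cases j <;> simp [Matrix.mul_apply, Fin.sum_univ_five] <;> ring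

/-- For every `a > 3`, the hexagon matrix has nonnegative rank exactly 5. -/
theorem nnRank_hexM_eq_five {a : ℝ} (ha : 3 < a) :
    nnRank (hexM a) = 5 := by
  have h5 := exists_nonneg_factorization_hexM_five (a := a) (by linarith)
  refine le_antisymm (Nat.sInf_le h5) ?_
  by_contra hlt
  have hmem := Nat.sInf_mem (s := {r : ℕ | ∃ (U : Matrix (Fin 6) (Fin r) ℝ)
    (V : Matrix (Fin r) (Fin 6) ℝ), (∀ i k, 0 ≤ U i k) ∧ (∀ k j, 0 ≤ V k j) ∧ hexM a = U * V})
    ⟨5, h5⟩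
  obtain ⟨U, V, hU, hV, hM⟩ := exists_nonneg_factorization_of_le (s := 4)
    (show nnRank (hexM a) ≤ 4 by omega) hmem
  exact hexM_ne_mul_of_nonneg ha U V hU hV hM
end

section
/- Let R ∈ ℝ^{p×n} and let v ∈ ℝ^n be a nonzero vector. Define u* ∈ ℝ^p by u*ᵢ = max(0, (Rv)ᵢ / ‖v‖₂²). Then u* is a minimizer of the function u ↦ ‖R − u·vᵀ‖_F² over the nonnegative orthant {u ∈ ℝ^p : u ≥ 0}: for every u ∈ ℝ^p with u ≥ 0, ‖R − u*·vᵀ‖_F² ≤ ‖R − u·vᵀ‖_F². -/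
theorem sum_sub_mul_sq {ι : Type*} [Fintype ι] (r v : ι → ℝ) (t : ℝ) :
    ∑ j, (r j - t * v j) ^ 2 = ∑ j, r j ^ 2 - 2 * t * (r ⬝ᵥ v) + t ^ 2 * ∑ j, v j ^ 2 := by
  simp only [dotProduct, Finset.mul_sum, ← Finset.sum_sub_distrib, ← Finset.sum_add_distrib]
  exact Finset.sum_congr rfl fun j _ => by ring

theorem quadratic_max_zero_div_le {b s t : ℝ} (hs : 0 < s) (ht : 0 ≤ t) :
    -(2 * max 0 (b / s) * b) + max 0 (b / s) ^ 2 * s ≤ -(2 * t * b) + t ^ 2 * s := by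
  obtain ⟨c, rfl⟩ : ∃ c, b = c * s := ⟨b / s, (div_mul_cancel₀ b hs.ne').symm⟩
  rw [mul_div_cancel_right₀ c hs.ne']
  rcases le_total c 0 with hc | hc
  · rw [max_eq_left hc]
    nlinarith [mul_nonneg (mul_nonneg ht (neg_nonneg.2 hc)) hs.le, mul_nonneg (sq_nonneg t) hs.le]
  · rw [max_eq_right hc]
    nlinarith [mul_nonneg (sq_nonneg (t - c)) hs.le]

/-- Closed-form solution of the column subproblem in HALS-type coordinate
descent for NMF: `u* = max(0, R v / ‖v‖₂²)` minimizes `‖R - u vᵀ‖_F²` over the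
nonnegative orthant. -/
theorem hals_column_subproblem {p n : ℕ}
    (R : Matrix (Fin p) (Fin n) ℝ) (v : Fin n → ℝ) (hv : v ≠ 0) :
    ∀ u : Fin p → ℝ, (∀ i, 0 ≤ u i) →
      ∑ i, ∑ j, (R i j - (max 0 (R.mulVec v i / ∑ l, v l ^ 2)) * v j) ^ 2
        ≤ ∑ i, ∑ j, (R i j - u i * v j) ^ 2 := by
  intro u hu
  have hs : 0 < ∑ l, v l ^ 2 := by
    obtain ⟨l, hl⟩ := Function.ne_iff.1 hv
    exact Finset.sum_pos' (fun _ _ => sq_nonneg _) ⟨l, Finset.mem_univ l, sq_pos_of_ne_zero hl⟩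
  refine Finset.sum_le_sum fun i _ => ?_
  rw [sum_sub_mul_sq, sum_sub_mul_sq]
  have h := quadratic_max_zero_div_le (b := R.mulVec v i) hs (hu i)
  simp only [Matrix.mulVec] at h ⊢
  linarith
end
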